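/- (Convergence bound for the implicit difference scheme.) Let m ≥ 2, n ≥ 1, α ∈ (0,1), β ∈ (0,1), γ ∈ (1,2), ω₁ > 0, ω₂ > 0, C > 0, δ > 0, and let d_{+,i}^{(k)}, d_{-,i}^{(k)}, e_{+,i}^{(k)}, e_{-,i}^{(k)} ≥ 0 be nonnegative reals for i ∈ {1,…,m−1}, k ∈ {1,…,n}. Suppose real numbers ψ_i^{(k)} (i ∈ {0,…,m}, k ∈ {0,…,n}) and residuals R_i^{(k)} satisfy: ψ_i^{(0)} = 0 for all i, ψ_0^{(k)} = ψ_m^{(k)} = 0 for all k, |R_i^{(k+1)}| ≤ C·δ for all i ∈ {1,…,m−1} and k ∈ {0,…,n−1}, and for all i ∈ {1,…,m−1}, k ∈ {0,…,n−1}: ψ_i^{(k+1)} + ω₁( d_{+,i}^{(k+1)} ∑_{j=0}^{i} g_j^{(β)} ψ_{i−j}^{(k+1)} + d_{-,i}^{(k+1)} ∑_{j=0}^{m−i} g_j^{(β)} ψ_{i+j}^{(k+1)} ) − ω₂( e_{+,i}^{(k+1)} ∑_{j=0}^{i+1} g_j^{(γ)} ψ_{i−j+1}^{(k+1)} + e_{-,i}^{(k+1)}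 ∑_{j=0}^{m−i+1} g_j^{(γ)} ψ_{i+j−1}^{(k+1)} ) = ψ_i^{(k)} − ∑_{j=1}^{k} a_j ( ψ_i^{(k−j+1)} − ψ_i^{(k−j)} ) + R_i^{(k+1)}. Then for every k ∈ {0,…,n−1}, max_{1 ≤ i ≤ m−1} |ψ_i^{(k+1)}| ≤ C · a_k^{-1} · δ. -/

import Mathlib

/-- Grünwald coefficient `g_j^(s) = ((-1)^j / j!) * s(s-1)⋯(s-j+1)` (with `g_0 = 1`). -/
noncomputable def grunwald (s : ℝ) (j : ℕ) : ℝ :=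
  (-1) ^ j / (Nat.factorial j : ℝ) * ∏ i ∈ Finset.range j, (s - i)

/-- `a_j = (j+1)^(1-α) - j^(1-α)` (real powers). -/
noncomputable def aCoef (α : ℝ) (j : ℕ) : ℝ :=
  ((j : ℝ) + 1) ^ (1 - α) - (j : ℝ) ^ (1 - α)

theorem grunwald_zero (s : ℝ) : grunwald s 0 = 1 := by
  simp [grunwald]

theorem grunwald_succ (s : ℝ) (j : ℕ) :
    ((j : ℝ) + 1) * grunwald s (j + 1) = (j - s) * grunwald s j := by
  have h : (Nat.factorial j : ℝ) ≠ 0 := by positivity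
  have h' : (j : ℝ) + 1 ≠ 0 := by positivity
  simp only [grunwald, Finset.prod_range_succ, Nat.factorial_succ, pow_succ]
  push_cast
  field_simp
  ring

theorem grunwald_one (s : ℝ) : grunwald s 1 = -s := by
  simp [grunwald]

/-- Partial sums of the Grünwald coefficients: `-s ∑_{j ≤ N} g_j = (N + 1) g_{N+1}`. -/
theorem neg_mul_sum_grunwald (s : ℝ) (N : ℕ) :
    -s * ∑ j ∈ Finset.range (N + 1), grunwald s j = ((N : ℝ) + 1) * grunwald s (N + 1) := by
  induction N with
  | zero => simp [grunwald_zero, grunwald_one]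
  | succ N ih =>
    rw [Finset.sum_range_succ, mul_add, ih, grunwald_succ s (N + 1)]
    push_cast
    ring

theorem grunwald_succ_nonpos {s : ℝ} (hs : s ∈ Set.Ioo (0 : ℝ) 1) (j : ℕ) :
    grunwald s (j + 1) ≤ 0 := by
  induction j with
  | zero => simpa [grunwald_one] using hs.1.le
  | succ j ih =>
    have h := grunwald_succ s (j + 1)
    have h1 : (0 : ℝ) < ((j + 1 : ℕ) : ℝ) + 1 := by positivity
    have h2 : (0 : ℝ) ≤ ((j + 1 : ℕ) : ℝ) - s := by
      have := hs.2
      have : (0 : ℝ) ≤ j := by positivity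
      push_cast
      linarith
    have h3 := mul_nonpos_of_nonneg_of_nonpos h2 ih
    rw [← h] at h3
    exact nonpos_of_mul_nonpos_right h3 h1

theorem grunwald_add_two_nonneg {s : ℝ} (hs : s ∈ Set.Ioo (1 : ℝ) 2) (j : ℕ) :
    0 ≤ grunwald s (j + 2) := by
  induction j with
  | zero =>
    have h := grunwald_succ s 1
    rw [grunwald_one] at h
    norm_num at h
    norm_num
    nlinarith [hs.1, hs.2]
  | succ j ih =>
    have h := grunwald_succ s (j + 2)
    have h1 : (0 : ℝ) < ((j + 2 : ℕ) : ℝ) + 1 := by positivity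
    have h2 : (0 : ℝ) ≤ ((j + 2 : ℕ) : ℝ) - s := by
      have := hs.2
      have : (0 : ℝ) ≤ j := by positivity
      push_cast
      linarith
    have h3 := mul_nonneg h2 ih
    rw [← h] at h3
    exact nonneg_of_mul_nonneg_right h3 h1

theorem sum_grunwald_nonneg {s : ℝ} (hs : s ∈ Set.Ioo (0 : ℝ) 1) (N : ℕ) :
    0 ≤ ∑ j ∈ Finset.range (N + 1), grunwald s j := by
  have h := neg_mul_sum_grunwald s N
  have h1 := mul_nonpos_of_nonneg_of_nonpos (by positivity : (0 : ℝ) ≤ (N : ℝ) + 1)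
    (grunwald_succ_nonpos hs N)
  nlinarith [hs.1]

theorem sum_grunwald_nonpos {s : ℝ} (hs : s ∈ Set.Ioo (1 : ℝ) 2) (N : ℕ) :
    ∑ j ∈ Finset.range (N + 2), grunwald s j ≤ 0 := by
  have h := neg_mul_sum_grunwald s (N + 1)
  have h1 := mul_nonneg (by positivity : (0 : ℝ) ≤ ((N + 1 : ℕ) : ℝ) + 1)
    (grunwald_add_two_nonneg hs N)
  rw [← h] at h1
  nlinarith [hs.1]

/-- The Grünwald sum of order in `(0, 1)` is nonnegative at a nonnegative maximum. -/
theorem sum_grunwald_mul_nonneg {s : ℝ} (hs : s ∈ Set.Ioo (0 : ℝ) 1) (N : ℕ) (u : ℕ → ℝ)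
    (h0 : 0 ≤ u 0) (hu : ∀ j ≤ N, u j ≤ u 0) :
    0 ≤ ∑ j ∈ Finset.range (N + 1), grunwald s j * u j := by
  refine (mul_nonneg (sum_grunwald_nonneg hs N) h0).trans ?_
  rw [Finset.sum_mul]
  refine Finset.sum_le_sum fun j hj => ?_
  rcases j with _ | j
  · exact le_rfl
  · exact mul_le_mul_of_nonpos_left (hu _ (by simpa using hj)) (grunwald_succ_nonpos hs j)

/-- The shifted Grünwald sum of order in `(1, 2)` is nonpositive at a nonnegative maximum. -/
theorem sum_grunwald_mul_nonpos {s : ℝ} (hs : s ∈ Set.Ioo (1 : ℝ) 2) (N : ℕ) (u : ℕ → ℝ)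
    (h1 : 0 ≤ u 1) (hu : ∀ j ≤ N + 1, u j ≤ u 1) :
    ∑ j ∈ Finset.range (N + 2), grunwald s j * u j ≤ 0 := by
  refine le_trans ?_ (mul_nonpos_of_nonpos_of_nonneg (sum_grunwald_nonpos hs N) h1)
  rw [Finset.sum_mul]
  refine Finset.sum_le_sum fun j hj => ?_
  have hj' : j ≤ N + 1 := by
    have := Finset.mem_range.mp hj
    omega
  rcases j with _ | _ | j
  · simpa [grunwald_zero] using hu 0 hj'
  · exact le_rfl
  · exact mul_le_mul_of_nonneg_left (hu _ hj') (grunwald_add_two_nonneg hs j)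

/-- The spatial operator of the implicit scheme. -/
noncomputable def schemeOp (m : ℕ) (β γ ω₁ ω₂ p q r t : ℝ) (v : ℕ → ℝ) (i : ℕ) : ℝ :=
  v i
    + ω₁ * (p * ∑ j ∈ Finset.range (i + 1), grunwald β j * v (i - j)
          + q * ∑ j ∈ Finset.range (m - i + 1), grunwald β j * v (i + j))
    - ω₂ * (r * ∑ j ∈ Finset.range (i + 2), grunwald γ j * v (i + 1 - j)
          + t * ∑ j ∈ Finset.range (m - i + 2), grunwald γ j * v (i + j - 1))

theorem schemeOp_neg (m : ℕ) (β γ ω₁ ω₂ p q r t : ℝ) (v : ℕ → ℝ) (i : ℕ) :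
    schemeOp m β γ ω₁ ω₂ p q r t (fun l => -v l) i = -schemeOp m β γ ω₁ ω₂ p q r t v i := by
  simp only [schemeOp, mul_neg, Finset.sum_neg_distrib]
  ring

section MaximumPrinciple

variable {m i : ℕ} {β γ ω₁ ω₂ p q r t : ℝ} {v : ℕ → ℝ}

theorem le_schemeOp (hβ : β ∈ Set.Ioo (0 : ℝ) 1) (hγ : γ ∈ Set.Ioo (1 : ℝ) 2)
    (hω₁ : 0 ≤ ω₁) (hω₂ : 0 ≤ ω₂) (hp : 0 ≤ p) (hq : 0 ≤ q) (hr : 0 ≤ r) (ht : 0 ≤ t)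
    (hi : 1 ≤ i) (him : i < m) (hv0 : 0 ≤ v i) (hv : ∀ l ≤ m, v l ≤ v i) :
    v i ≤ schemeOp m β γ ω₁ ω₂ p q r t v i := by
  have h1 := sum_grunwald_mul_nonneg hβ i (fun j => v (i - j)) hv0
    (fun j _ => hv _ (by omega))
  have h2 := sum_grunwald_mul_nonneg hβ (m - i) (fun j => v (i + j)) hv0
    (fun j _ => hv _ (by omega))
  have h3 := sum_grunwald_mul_nonpos hγ i (fun j => v (i + 1 - j)) hv0
    (fun j _ => hv _ (by omega))
  have h4 := sum_grunwald_mul_nonpos hγ (m - i) (fun j => v (i + j - 1)) hv0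
    (fun j _ => hv _ (by omega))
  have h5 := mul_nonneg hω₁ (add_nonneg (mul_nonneg hp h1) (mul_nonneg hq h2))
  have h6 := mul_nonpos_of_nonneg_of_nonpos hω₂ (add_nonpos
    (mul_nonpos_of_nonneg_of_nonpos hr h3) (mul_nonpos_of_nonneg_of_nonpos ht h4))
  unfold schemeOp
  linarith

/-- Discrete maximum principle for the spatial operator. -/
theorem abs_le_abs_schemeOp (hβ : β ∈ Set.Ioo (0 : ℝ) 1) (hγ : γ ∈ Set.Ioo (1 : ℝ) 2)
    (hω₁ : 0 ≤ ω₁) (hω₂ : 0 ≤ ω₂) (hp : 0 ≤ p) (hq : 0 ≤ q) (hr : 0 ≤ r) (ht : 0 ≤ t)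
    (hi : 1 ≤ i) (him : i < m) (hv : ∀ l ≤ m, |v l| ≤ |v i|) :
    |v i| ≤ |schemeOp m β γ ω₁ ω₂ p q r t v i| := by
  rcases le_total 0 (v i) with h | h
  · rw [abs_of_nonneg h] at hv ⊢
    exact (le_schemeOp hβ hγ hω₁ hω₂ hp hq hr ht hi him h
      fun l hl => (le_abs_self _).trans (hv l hl)).trans (le_abs_self _)
  · rw [abs_of_nonpos h] at hv ⊢
    have := le_schemeOp (v := fun l => -v l) hβ hγ hω₁ hω₂ hp hq hr ht hi him
      (neg_nonneg.mpr h) fun l hl => (neg_le_abs _).trans (hv l hl)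
    rw [schemeOp_neg] at this
    exact this.trans (neg_le_abs _)

end MaximumPrinciple

theorem aCoef_zero {α : ℝ} (hα : α < 1) : aCoef α 0 = 1 := by
  have : (1 : ℝ) - α ≠ 0 := by linarith
  simp [aCoef, Real.zero_rpow this]

theorem aCoef_pos {α : ℝ} (hα : α < 1) (j : ℕ) : 0 < aCoef α j :=
  sub_pos.mpr (Real.rpow_lt_rpow (by positivity) (by linarith) (by linarith))

theorem aCoef_antitone {α : ℝ} (hα : α ∈ Set.Ioo (0 : ℝ) 1) : Antitone (aCoef α) := by
  refine antitone_nat_of_succ_le fun j => ?_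
  have hc := Real.concaveOn_rpow (p := 1 - α) (by linarith [hα.2]) (by linarith [hα.1])
  have h := hc.2 (by simp : (j : ℝ) ∈ Set.Ici 0)
    (by simp only [Set.mem_Ici]; positivity : (j : ℝ) + 1 + 1 ∈ Set.Ici 0)
    (by norm_num : (0 : ℝ) ≤ 1 / 2) (by norm_num : (0 : ℝ) ≤ 1 / 2) (by norm_num)
  have e : (1 / 2 : ℝ) • (j : ℝ) + (1 / 2 : ℝ) • ((j : ℝ) + 1 + 1) = j + 1 := by
    simp only [smul_eq_mul]
    ring
  simp only [e] at h
  simp only [smul_eq_mul] at h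
  unfold aCoef
  push_cast
  linarith

/-- Summation by parts for the discrete fractional time derivative. -/
theorem sub_sum_mul_sub (a f : ℕ → ℝ) (ha : a 0 = 1) (k N : ℕ) :
    f k - ∑ j ∈ Finset.Icc 1 N, a j * (f (k + 1 - j) - f (k - j))
      = ∑ j ∈ Finset.range N, (a j - a (j + 1)) * f (k - j) + a N * f (k - N) := by
  induction N with
  | zero => simp [ha]
  | succ N ih =>
    rw [Finset.sum_Icc_succ_top (by omega), Finset.sum_range_succ, ← sub_sub, ih,
      Nat.add_sub_add_right]
    ring

/-- Convergence bound for the implicit difference scheme: if the local truncation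
errors satisfy `|R_i^{(k+1)}| ≤ C·δ`, then the global error at time level `k+1` is
bounded by `C · a_k⁻¹ · δ`. (Indices: `ψ i k` is `ψ_i^{(k)}`; subtraction of natural
indices such as `i - j + 1` is written `i + 1 - j` so that it agrees with the integer
value on the admissible range.) -/
theorem stmt19 (m n : ℕ) (hm : 2 ≤ m) (hn : 1 ≤ n)
    (α β γ ω₁ ω₂ C δ : ℝ)
    (hα : α ∈ Set.Ioo (0 : ℝ) 1) (hβ : β ∈ Set.Ioo (0 : ℝ) 1)
    (hγ : γ ∈ Set.Ioo (1 : ℝ) 2) (hω₁ : 0 < ω₁) (hω₂ : 0 < ω₂)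
    (hC : 0 < C) (hδ : 0 < δ)
    (dp dm ep em : ℕ → ℕ → ℝ)
    (hdp : ∀ i k, 1 ≤ i → i ≤ m - 1 → 1 ≤ k → k ≤ n → 0 ≤ dp i k)
    (hdm : ∀ i k, 1 ≤ i → i ≤ m - 1 → 1 ≤ k → k ≤ n → 0 ≤ dm i k)
    (hep : ∀ i k, 1 ≤ i → i ≤ m - 1 → 1 ≤ k → k ≤ n → 0 ≤ ep i k)
    (hem : ∀ i k, 1 ≤ i → i ≤ m - 1 → 1 ≤ k → k ≤ n → 0 ≤ em i k)
    (ψ R : ℕ → ℕ → ℝ)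
    (hinit : ∀ i, i ≤ m → ψ i 0 = 0)
    (hbd0 : ∀ k, k ≤ n → ψ 0 k = 0)
    (hbdm : ∀ k, k ≤ n → ψ m k = 0)
    (hR : ∀ i k, 1 ≤ i → i ≤ m - 1 → k < n → |R i (k + 1)| ≤ C * δ)
    (hrec : ∀ i k, 1 ≤ i → i ≤ m - 1 → k < n →
      ψ i (k + 1)
        + ω₁ * (dp i (k + 1) * ∑ j ∈ Finset.range (i + 1), grunwald β j * ψ (i - j) (k + 1)
              + dm i (k + 1) * ∑ j ∈ Finset.range (m - i + 1), grunwald β j * ψ (i + j) (k + 1))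
        - ω₂ * (ep i (k + 1) * ∑ j ∈ Finset.range (i + 2), grunwald γ j * ψ (i + 1 - j) (k + 1)
              + em i (k + 1) * ∑ j ∈ Finset.range (m - i + 2), grunwald γ j * ψ (i + j - 1) (k + 1))
      = ψ i k - (∑ j ∈ Finset.Icc 1 k, aCoef α j * (ψ i (k + 1 - j) - ψ i (k - j)))
          + R i (k + 1)) :
    ∀ k, k < n →
      (Finset.Icc 1 (m - 1)).sup' (Finset.nonempty_Icc.mpr (by omega))
          (fun i => |ψ i (k + 1)|) ≤ C * (aCoef α k)⁻¹ * δ := by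
  have hanti := aCoef_antitone hα
  have ha0 := aCoef_zero hα.2
  have hCδ : 0 < C * δ := mul_pos hC hδ
  intro k
  induction k using Nat.strong_induction_on with
  | _ k ih =>
    intro hk
    obtain ⟨i, hi, hsup⟩ := Finset.exists_mem_eq_sup' (s := Finset.Icc 1 (m - 1))
      (Finset.nonempty_Icc.mpr (by omega)) (fun i => |ψ i (k + 1)|)
    have hmax : ∀ l ≤ m, |ψ l (k + 1)| ≤ |ψ i (k + 1)| := by
      intro l hl
      by_cases h0 : l = 0
      · simp [h0, hbd0 (k + 1) hk]
      by_cases h1 : l = m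
      · simp [h1, hbdm (k + 1) hk]
      rw [← hsup]
      exact Finset.le_sup' (fun i => |ψ i (k + 1)|) (Finset.mem_Icc.mpr (by omega))
    obtain ⟨hi1, hi2⟩ := Finset.mem_Icc.mp hi
    rw [hsup]
    have hop := abs_le_abs_schemeOp (v := fun l => ψ l (k + 1)) hβ hγ hω₁.le hω₂.le
      (hdp i (k + 1) hi1 hi2 (by omega) hk) (hdm i (k + 1) hi1 hi2 (by omega) hk)
      (hep i (k + 1) hi1 hi2 (by omega) hk) (hem i (k + 1) hi1 hi2 (by omega) hk)
      hi1 (by omega) hmax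
    rw [schemeOp, hrec i k hi1 hi2 hk, sub_sum_mul_sub (aCoef α) (ψ i) ha0 k k, Nat.sub_self,
      hinit i (by omega), mul_zero, add_zero] at hop
    have hak := aCoef_pos hα.2 k
    have hsum : |∑ j ∈ Finset.range k, (aCoef α j - aCoef α (j + 1)) * ψ i (k - j)|
        ≤ (1 - aCoef α k) * (C * (aCoef α k)⁻¹ * δ) := by
      rw [← ha0, ← Finset.sum_range_sub', Finset.sum_mul]
      refine (Finset.abs_sum_le_sum_abs _ _).trans (Finset.sum_le_sum fun j hj => ?_)
      have hjk := Finset.mem_range.mp hj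
      have hd : 0 ≤ aCoef α j - aCoef α (j + 1) := sub_nonneg.mpr (hanti (Nat.le_succ j))
      rw [abs_mul, abs_of_nonneg hd]
      refine mul_le_mul_of_nonneg_left ?_ hd
      have hb := (Finset.le_sup' (fun i => |ψ i (k - j - 1 + 1)|) hi).trans
        (ih (k - j - 1) (by omega) (by omega))
      rw [Nat.sub_add_cancel (by omega)] at hb
      refine hb.trans ?_
      have := aCoef_pos hα.2 (k - j - 1)
      gcongr
      exact hanti (by omega)
    have hRk := hR i k hi1 hi2 hk
    have hfin : (1 - aCoef α k) * (C * (aCoef α k)⁻¹ * δ) + C * δ = C * (aCoef α k)⁻¹ * δ := by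
      field_simp
      ring
    exact hop.trans ((abs_add_le _ _).trans (by linarith))
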